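/- Under the hierarchical model with spike-and-slab prior on β_γ, DAG-Wishart prior on (D,L), Erdos–Renyi prior on D and MRF prior on γ, the marginal joint posterior satisfies π(γ, D | Y, X) ∝ π(γ|D) π(D) · [z_D(U + XᵀX, n + α(D)) / z_D(U, α(D))] · det(τ² X_γᵀ X_γ + I_{|γ|})^{−1/2} · exp{−(1/2σ²) Yᵀ (I_n + τ² X_γ X_γᵀ)⁻¹ Y}. -/

import Mathlib

open Matrix Real MeasureTheory Finset

noncomputable section

/-- Unit lower triangular Cholesky factor built from a parent structure and free entries. -/
def cholFactor {p : ℕ} (pa : Fin p → Finset (Fin p))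
    (l : ∀ i : Fin p, {j // j ∈ pa i} → ℝ) : Matrix (Fin p) (Fin p) ℝ :=
  fun j i => if j = i then 1 else if h : j ∈ pa i then l i ⟨j, h⟩ else 0

def subGT {p : ℕ} (pa : Fin p → Finset (Fin p))
    (U : Matrix (Fin p) (Fin p) ℝ) (i : Fin p) :
    Matrix {j // j ∈ pa i} {j // j ∈ pa i} ℝ :=
  Matrix.of fun a b => U a.1 b.1

def subGE {p : ℕ} (pa : Fin p → Finset (Fin p))
    (U : Matrix (Fin p) (Fin p) ℝ) (i : Fin p) :
    Matrix (Unit ⊕ {j // j ∈ pa i}) (Unit ⊕ {j // j ∈ pa i}) ℝ :=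
  Matrix.fromBlocks (Matrix.of fun _ _ => U i i) (Matrix.of fun _ b => U i b.1)
    (Matrix.of fun a _ => U a.1 i) (subGT pa U i)

/-- The DAG-Wishart normalizing constant `z_D(U, α)`. -/
def zDAG {p : ℕ} (pa : Fin p → Finset (Fin p))
    (U : Matrix (Fin p) (Fin p) ℝ) (α : Fin p → ℝ) : ℝ :=
  ∏ i : Fin p,
    Real.Gamma (α i / 2 - ((pa i).card : ℝ) / 2 - 1)
      * (2 : ℝ) ^ (α i / 2 - 1)
      * Real.sqrt π ^ ((pa i).card)
      * (subGT pa U i).det ^ (α i / 2 - ((pa i).card : ℝ) / 2 - 3 / 2)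
      / (subGE pa U i).det ^ (α i / 2 - ((pa i).card : ℝ) / 2 - 1)

/-- The normalized DAG-Wishart prior density at `(diagonal d, cholFactor pa l)`. -/
def dagWishartDensity {p : ℕ} (pa : Fin p → Finset (Fin p))
    (U : Matrix (Fin p) (Fin p) ℝ) (α : Fin p → ℝ)
    (d : Fin p → ℝ) (l : ∀ i : Fin p, {j // j ∈ pa i} → ℝ) : ℝ :=
  (zDAG pa U α)⁻¹
    * Real.exp (-(1 / 2) * Matrix.trace
        ((cholFactor pa l * (Matrix.diagonal d)⁻¹ * (cholFactor pa l).transpose) * U))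
    * (∏ i : Fin p, (d i) ^ (-(α i) / 2))
    * (if ∀ i, 0 < d i then 1 else 0)

/-- The Gaussian density of `N_p(0, Ω⁻¹)` (precision matrix `Ω`) at `x`. -/
def gaussDensity {p : ℕ} (Ω : Matrix (Fin p) (Fin p) ℝ) (x : Fin p → ℝ) : ℝ :=
  (2 * π) ^ (-(p : ℝ) / 2) * Ω.det ^ ((1 : ℝ) / 2)
    * Real.exp (-(1 / 2) * (x ⬝ᵥ (Ω *ᵥ x)))

/-- The design matrix restricted to the active columns of `γ`. -/
def designSub {n p : ℕ} (X : Matrix (Fin n) (Fin p) ℝ) (γ : Fin p → Bool) :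
    Matrix (Fin n) {i // γ i = true} ℝ :=
  X.submatrix id (fun a => a.1)

/-- The adjacency matrix `G` of the DAG described by the parent structure `pa`. -/
def adjMat {p : ℕ} (pa : Fin p → Finset (Fin p)) : Matrix (Fin p) (Fin p) ℝ :=
  fun i j => if i ∈ pa j ∨ j ∈ pa i then 1 else 0

/-- The Erdos–Renyi prior `π(𝒟) ∝ ∏_j q^{ν_j} (1-q)^{(p-j)-ν_j} 1{max ν_j < R}`. -/
def dagPrior {p : ℕ} (q : ℝ) (R : ℕ) (pa : Fin p → Finset (Fin p)) : ℝ :=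
  (∏ j : Fin p, q ^ ((pa j).card)
      * (1 - q) ^ ((Finset.univ.filter (fun i : Fin p => j < i)).card - (pa j).card))
    * (if ∀ j : Fin p, (pa j).card < R then 1 else 0)

/-- The unnormalized MRF prior weight `exp(−a 1ᵀγ + b γᵀ G γ) 1{|γ| < R}`. -/
def mrfWeight {p : ℕ} (a b : ℝ) (R : ℕ) (pa : Fin p → Finset (Fin p))
    (γ : Fin p → Bool) : ℝ :=
  Real.exp (-a * ((Finset.univ.filter (fun i => γ i = true)).card : ℝ)
      + b * ((fun i => if γ i then (1 : ℝ) else 0)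
          ⬝ᵥ (adjMat pa *ᵥ fun i => if γ i then (1 : ℝ) else 0)))
    * (if (Finset.univ.filter (fun i => γ i = true)).card < R then 1 else 0)

/-- The normalized MRF prior `π(γ | 𝒟)`. -/
def mrfPrior {p : ℕ} (a b : ℝ) (R : ℕ) (pa : Fin p → Finset (Fin p))
    (γ : Fin p → Bool) : ℝ :=
  mrfWeight a b R pa γ / ∑ γ' : Fin p → Bool, mrfWeight a b R pa γ'


lemma gauss_std {ι : Type*} [Fintype ι] :
    Integrable (fun x : ι → ℝ => Real.exp (-(x ⬝ᵥ x) / 2)) ∧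
    ∫ x : ι → ℝ, Real.exp (-(x ⬝ᵥ x) / 2) = (2 * π) ^ ((Fintype.card ι : ℝ) / 2) := by
  have e : (fun x : ι → ℝ => Real.exp (-(x ⬝ᵥ x) / 2))
      = fun x => ∏ i, Real.exp (-(1/2) * (x i) ^ 2) := by
    funext x
    rw [← Real.exp_sum]
    congr 1
    simp only [dotProduct, ← Finset.mul_sum, ← pow_two]
    ring
  rw [e]
  constructor
  · exact Integrable.fintype_prod (f := fun i (v : ℝ) ↦ Real.exp (-(1/2) * v ^ 2))
      (fun i ↦ integrable_exp_neg_mul_sq (by norm_num))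
  · rw [integral_fintype_prod_volume_eq_pow (fun v : ℝ => Real.exp (-(1/2) * v ^ 2)),
      integral_gaussian, Real.sqrt_eq_rpow, ← Real.rpow_natCast, ← Real.rpow_mul (by positivity)]
    congr 1
    · ring
    · ring

open scoped MatrixOrder in
lemma posDef_factor {ι : Type*} [Fintype ι] [DecidableEq ι] (A : Matrix ι ι ℝ) (hA : A.PosDef) :
    ∃ B : Matrix ι ι ℝ, A = Bᴴ * B :=
  CStarAlgebra.nonneg_iff_eq_star_mul_self.1 hA.posSemidef.nonneg

lemma gauss_pd {ι : Type*} [Fintype ι] [DecidableEq ι] (A : Matrix ι ι ℝ) (hA : A.PosDef) :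
    Integrable (fun x : ι → ℝ => Real.exp (-(x ⬝ᵥ (A *ᵥ x)) / 2)) ∧
    ∫ x : ι → ℝ, Real.exp (-(x ⬝ᵥ (A *ᵥ x)) / 2)
      = (2 * π) ^ ((Fintype.card ι : ℝ) / 2) * A.det ^ (-(1:ℝ)/2) := by
  obtain ⟨B, hB⟩ := posDef_factor A hA
  have hdet : A.det = B.det ^ 2 := by
    rw [hB, det_mul, det_conjTranspose]; simp [pow_two]
  have hB0 : B.det ≠ 0 := by
    intro h; have := hA.det_pos; rw [hdet, h] at this; simp at this
  have e : (fun x : ι → ℝ => Real.exp (-(x ⬝ᵥ (A *ᵥ x)) / 2))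
      = fun x => (fun y : ι → ℝ => Real.exp (-(y ⬝ᵥ y) / 2)) (toLin' B x) := by
    funext x
    simp only [toLin'_apply]
    rw [hB, ← mulVec_mulVec, dotProduct_mulVec, conjTranspose_eq_transpose_of_trivial,
      vecMul_transpose]
  have hm := Real.map_matrix_volume_pi_eq_smul_volume_pi hB0
  have hme : Measurable (toLin' B) := (LinearMap.continuous_of_finiteDimensional _).measurable
  have hc : Continuous (fun y : ι → ℝ => Real.exp (-(y ⬝ᵥ y) / 2)) := by
    unfold dotProduct; fun_prop
  rw [e]
  constructor
  · refine Integrable.comp_measurable (g := fun y : ι → ℝ => Real.exp (-(y ⬝ᵥ y) / 2)) ?_ hme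
    rw [hm]
    exact (gauss_std.1).smul_measure ENNReal.ofReal_ne_top
  · rw [← integral_map (φ := toLin' B) hme.aemeasurable hc.aestronglyMeasurable, hm,
      integral_smul_measure, gauss_std.2, ENNReal.toReal_ofReal (abs_nonneg _), smul_eq_mul,
      mul_comm, hdet, ← sq_abs, ← Real.rpow_natCast, ← Real.rpow_mul (abs_nonneg _), abs_inv,
      ← Real.rpow_neg_one]
    norm_num

lemma square_complete {ι : Type*} [Fintype ι] [DecidableEq ι] (A : Matrix ι ι ℝ) (hA : A.PosDef)
    (u l : ι → ℝ) (w : ℝ) :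
    w + 2 * (u ⬝ᵥ l) + l ⬝ᵥ (A *ᵥ l)
      = (l + A⁻¹ *ᵥ u) ⬝ᵥ (A *ᵥ (l + A⁻¹ *ᵥ u)) + (w - u ⬝ᵥ (A⁻¹ *ᵥ u)) := by
  have hu : IsUnit A.det := isUnit_iff_ne_zero.2 hA.det_pos.ne'
  have hT : Aᵀ = A := by
    have := hA.isHermitian; rwa [IsHermitian, conjTranspose_eq_transpose_of_trivial] at this
  have h1 : A *ᵥ (A⁻¹ *ᵥ u) = u := by
    rw [mulVec_mulVec, mul_nonsing_inv _ hu, one_mulVec]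
  have h2 : (A⁻¹ *ᵥ u) ⬝ᵥ (A *ᵥ l) = u ⬝ᵥ l := by
    rw [dotProduct_mulVec, ← mulVec_transpose, hT, h1]
  rw [mulVec_add, h1, add_dotProduct, dotProduct_add, dotProduct_add, h2,
    dotProduct_comm l u, dotProduct_comm _ u]
  ring

lemma gauss_shift {ι : Type*} [Fintype ι] [DecidableEq ι] (A : Matrix ι ι ℝ) (hA : A.PosDef)
    (u : ι → ℝ) (w d : ℝ) (hd : 0 < d) :
    Integrable (fun l : ι → ℝ => Real.exp (-(w + 2 * (u ⬝ᵥ l) + l ⬝ᵥ (A *ᵥ l)) / (2 * d))) ∧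
    ∫ l : ι → ℝ, Real.exp (-(w + 2 * (u ⬝ᵥ l) + l ⬝ᵥ (A *ᵥ l)) / (2 * d))
      = (2 * π) ^ ((Fintype.card ι : ℝ) / 2) * d ^ ((Fintype.card ι : ℝ) / 2)
        * A.det ^ (-(1:ℝ)/2) * Real.exp (-(w - u ⬝ᵥ (A⁻¹ *ᵥ u)) / (2 * d)) := by
  have hA' : (d⁻¹ • A).PosDef := hA.smul (by positivity)
  obtain ⟨h1, h2⟩ := gauss_pd _ hA'
  have e : (fun l : ι → ℝ => Real.exp (-(w + 2 * (u ⬝ᵥ l) + l ⬝ᵥ (A *ᵥ l)) / (2 * d)))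
      = fun l => (fun x : ι → ℝ => Real.exp (-(x ⬝ᵥ ((d⁻¹ • A) *ᵥ x)) / 2)) (l + A⁻¹ *ᵥ u)
        * Real.exp (-(w - u ⬝ᵥ (A⁻¹ *ᵥ u)) / (2 * d)) := by
    funext l
    simp only
    rw [square_complete A hA, ← Real.exp_add, smul_mulVec, dotProduct_smul, smul_eq_mul]
    congr 1
    field_simp
    ring
  rw [e]
  constructor
  · exact (h1.comp_add_right (A⁻¹ *ᵥ u)).mul_const _
  · rw [integral_mul_const,
      integral_add_right_eq_self (fun x : ι → ℝ => Real.exp (-(x ⬝ᵥ ((d⁻¹ • A) *ᵥ x)) / 2)), h2,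
      det_smul, Real.mul_rpow (by positivity) hA.det_pos.le, ← Real.rpow_natCast,
      ← Real.rpow_mul (by positivity), Real.inv_rpow hd.le, ← Real.rpow_neg hd.le]
    congr 1
    rw [show -((Fintype.card ι : ℝ) * (-1/2)) = (Fintype.card ι : ℝ) / 2 by ring]
    ring

lemma invgamma (m r : ℝ) (hm : 0 < m) (hr : 0 < r) :
    IntegrableOn (fun x : ℝ => x ^ (-m-1) * Real.exp (-r / x)) (Set.Ioi 0) ∧
    ∫ x in Set.Ioi (0:ℝ), x ^ (-m-1) * Real.exp (-r / x) = Real.Gamma m * r ^ (-m) := by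
  have e : Set.EqOn (fun x : ℝ => (|(-1:ℝ)| * x ^ ((-1:ℝ)-1)) •
      (fun t : ℝ => t ^ (m-1) * Real.exp (-(r * t))) (x ^ (-1:ℝ)))
      (fun x : ℝ => x ^ (-m-1) * Real.exp (-r / x)) (Set.Ioi 0) := by
    intro x hx
    have hx : 0 < x := hx
    simp only [smul_eq_mul]
    rw [← Real.rpow_mul hx.le, ← mul_assoc, abs_neg, abs_one, one_mul, ← Real.rpow_add hx,
      Real.rpow_neg_one]
    congr 2
    · ring
    · rw [neg_div, div_eq_mul_inv]
  constructor
  · refine IntegrableOn.congr_fun ?_ e measurableSet_Ioi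
    rw [integrableOn_Ioi_comp_rpow_iff (fun t : ℝ => t ^ (m-1) * Real.exp (-(r * t))) (by norm_num : (-1:ℝ) ≠ 0)]
    have := integrableOn_rpow_mul_exp_neg_mul_rpow (p := 1) (s := m - 1) (b := r)
      (by linarith) (by norm_num) hr
    simpa using this
  · rw [← setIntegral_congr_fun measurableSet_Ioi e,
      integral_comp_rpow_Ioi (fun t : ℝ => t ^ (m-1) * Real.exp (-(r * t))) (by norm_num : (-1:ℝ) ≠ 0),
      integral_rpow_mul_exp_neg_mul_Ioi hm hr, Real.rpow_neg hr.le, one_div, Real.inv_rpow hr.le]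
    ring

/-- one-vertex integral -/
lemma vertex_int {ι : Type*} [Fintype ι] [DecidableEq ι] (A : Matrix ι ι ℝ) (hA : A.PosDef)
    (u : ι → ℝ) (w α : ℝ) (hs : 0 < w - u ⬝ᵥ (A⁻¹ *ᵥ u))
    (hα : 2 < α - (Fintype.card ι : ℝ)) :
    ∫ l : ι → ℝ, ∫ d : ℝ, (Set.Ioi (0:ℝ)).indicator (fun d => d ^ (-α/2) *
       Real.exp (-(w + 2 * (u ⬝ᵥ l) + l ⬝ᵥ (A *ᵥ l)) / (2 * d))) d
    = Real.Gamma (α / 2 - (Fintype.card ι : ℝ) / 2 - 1) * (2:ℝ) ^ (α / 2 - 1)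
      * Real.sqrt π ^ (Fintype.card ι) * A.det ^ (-(1:ℝ)/2)
      * (w - u ⬝ᵥ (A⁻¹ *ᵥ u)) ^ (-(α / 2 - (Fintype.card ι : ℝ) / 2 - 1)) := by
  set k : ℝ := (Fintype.card ι : ℝ) with hk
  set s := w - u ⬝ᵥ (A⁻¹ *ᵥ u) with hsdef
  set m := α / 2 - k / 2 - 1 with hm
  have hm0 : 0 < m := by rw [hm]; linarith
  set F : (ι → ℝ) → ℝ → ℝ := fun l d => (Set.Ioi (0:ℝ)).indicator (fun d => d ^ (-α/2) *
       Real.exp (-(w + 2 * (u ⬝ᵥ l) + l ⬝ᵥ (A *ᵥ l)) / (2 * d))) d with hF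
  have hFnn : ∀ l d, 0 ≤ F l d := by
    intro l d
    apply Set.indicator_nonneg
    intro x hx
    have : 0 < x := hx
    positivity
  have hinner : ∀ d, ∫ l, F l d = (Set.Ioi (0:ℝ)).indicator (fun d =>
      ((2 * π) ^ (k / 2) * A.det ^ (-(1:ℝ)/2)) * (d ^ (-m-1) * Real.exp (-(s/2) / d))) d := by
    intro d
    by_cases hd : d ∈ Set.Ioi (0:ℝ)
    · have hd' : 0 < d := hd
      simp only [hF, Set.indicator_of_mem hd]
      rw [integral_const_mul, (gauss_shift A hA u w d hd').2,
        show -m-1 = -α/2 + k/2 by rw [hm]; ring, Real.rpow_add hd', ← hsdef, ← hk,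
        show -(s/2)/d = -s/(2*d) by field_simp]
      ring
    · simp only [hF, Set.indicator_of_notMem hd]; simp
  have hint := (invgamma m (s/2) hm0 (by positivity))
  have hmeas : Measurable (Function.uncurry F) := by
    have : Function.uncurry F = (Set.univ ×ˢ Set.Ioi (0:ℝ)).indicator (fun q : (ι → ℝ) × ℝ =>
        q.2 ^ (-α/2) *
       Real.exp (-(w + 2 * (u ⬝ᵥ q.1) + q.1 ⬝ᵥ (A *ᵥ q.1)) / (2 * q.2))) := by
      funext q
      by_cases hq : q.2 ∈ Set.Ioi (0:ℝ)
      · rw [Set.indicator_of_mem (by simpa using hq)]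
        simp only [Function.uncurry, hF, Set.indicator_of_mem hq]
      · rw [Set.indicator_of_notMem (by simpa using hq)]
        simp only [Function.uncurry, hF, Set.indicator_of_notMem hq]
    rw [this]
    refine Measurable.indicator ?_ (MeasurableSet.univ.prod measurableSet_Ioi)
    simp only [dotProduct, mulVec]
    fun_prop
  have hFint : Integrable (Function.uncurry F) (volume.prod volume) := by
    rw [integrable_prod_iff' hmeas.aestronglyMeasurable]
    constructor
    · refine Filter.Eventually.of_forall fun d => ?_
      by_cases hd : d ∈ Set.Ioi (0:ℝ)
      · simp only [Function.uncurry, hF, Set.indicator_of_mem hd]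
        exact (gauss_shift A hA u w d hd).1.const_mul _
      · simp only [Function.uncurry, hF, Set.indicator_of_notMem hd]; simp
    · have : (fun d => ∫ l, ‖Function.uncurry F (l, d)‖) = (Set.Ioi (0:ℝ)).indicator (fun d =>
          ((2 * π) ^ (k / 2) * A.det ^ (-(1:ℝ)/2)) * (d ^ (-m-1) * Real.exp (-(s/2) / d))) := by
        funext d
        rw [← hinner]
        simp only [Function.uncurry, Real.norm_of_nonneg (hFnn _ _)]
      rw [this, integrable_indicator_iff measurableSet_Ioi]
      exact hint.1.const_mul _
  rw [integral_integral_swap hFint]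
  simp_rw [hinner]
  rw [integral_indicator measurableSet_Ioi, integral_const_mul, hint.2,
    Real.div_rpow hs.le (by norm_num), Real.rpow_neg (by norm_num : (0:ℝ) ≤ 2), div_inv_eq_mul,
    Real.mul_rpow (by norm_num) (by positivity), Real.sqrt_eq_rpow, ← Real.rpow_natCast (π ^ _),
    ← Real.rpow_mul (by positivity),
    show α/2 - 1 = k/2 + m by rw [hm]; ring, Real.rpow_add (by norm_num), ← hk,
    show 1/2*k = k/2 by ring]
  ring

lemma col_sum {p : ℕ} (pa : Fin p → Finset (Fin p)) (i : Fin p) (hi : i ∉ pa i)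
    (l : ∀ i : Fin p, {j // j ∈ pa i} → ℝ) (g : Fin p → ℝ) :
    ∑ j, cholFactor pa l j i * g j = g i + ∑ a : {j // j ∈ pa i}, l i a * g a.1 := by
  have h : ∀ j, cholFactor pa l j i * g j = (if j = i then g j else 0)
      + (if h : j ∈ pa i then l i ⟨j, h⟩ * g j else 0) := by
    intro j
    unfold cholFactor
    by_cases hji : j = i
    · subst hji; simp [hi]
    · by_cases hj : j ∈ pa i <;> simp [hji, hj]
  simp_rw [h]
  rw [Finset.sum_add_distrib, Finset.sum_ite_eq' Finset.univ i g]
  simp only [Finset.mem_univ, if_true]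
  congr 1
  rw [Finset.sum_dite]
  simp only [Finset.sum_const_zero, add_zero]
  refine Finset.sum_bij' (fun x _ => ⟨x.1, (Finset.mem_filter.1 x.2).2⟩)
    (fun a _ => ⟨a.1, Finset.mem_filter.2 ⟨Finset.mem_univ _, a.2⟩⟩) ?_ ?_ ?_ ?_ ?_ <;> simp

lemma col_quad {p : ℕ} (pa : Fin p → Finset (Fin p)) (i : Fin p) (hi : i ∉ pa i)
    (l : ∀ i : Fin p, {j // j ∈ pa i} → ℝ) (V : Matrix (Fin p) (Fin p) ℝ) (hV : Vᵀ = V) :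
    ∑ j, cholFactor pa l j i * ∑ k, cholFactor pa l k i * V j k
      = V i i + 2 * ((fun a : {j // j ∈ pa i} => V i a.1) ⬝ᵥ l i)
        + l i ⬝ᵥ (subGT pa V i *ᵥ l i) := by
  have hs : ∀ a b, V a b = V b a := fun a b => congrFun (congrFun hV b) a
  simp_rw [fun j => col_sum pa i hi l (fun k => V j k)]
  rw [col_sum pa i hi l (fun j => V j i + ∑ a : {j // j ∈ pa i}, l i a * V j a.1)]
  simp only [dotProduct, mulVec, subGT, Matrix.of_apply, mul_add, Finset.sum_add_distrib]
  have e1 : ∀ a : {j // j ∈ pa i}, l i a * V a.1 i = V i a.1 * l i a := fun a => by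
    rw [hs a.1 i, mul_comm]
  have e2 : ∀ a : {j // j ∈ pa i}, l i a * V i a.1 = V i a.1 * l i a := fun a => mul_comm _ _
  have e3 : ∀ a b : {j // j ∈ pa i}, l i b * V a.1 b.1 = V a.1 b.1 * l i b :=
    fun a b => mul_comm _ _
  simp_rw [e1, e2, e3]
  ring

lemma trace_quad {p : ℕ} (L : Matrix (Fin p) (Fin p) ℝ) (e : Fin p → ℝ)
    (V : Matrix (Fin p) (Fin p) ℝ) (hV : Vᵀ = V) :
    Matrix.trace (L * Matrix.diagonal e * Lᵀ * V)
      = ∑ i, e i * ∑ j, L j i * ∑ k, L k i * V j k := by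
  have hs : ∀ a b, V a b = V b a := fun a b => congrFun (congrFun hV b) a
  simp only [Matrix.trace, Matrix.diag, Matrix.mul_apply (M := L * Matrix.diagonal e * Lᵀ),
    Matrix.mul_apply (M := L * Matrix.diagonal e), Matrix.mul_diagonal, Matrix.transpose_apply,
    Finset.sum_mul, Finset.mul_sum]
  rw [Finset.sum_congr rfl fun x _ => Finset.sum_comm, Finset.sum_comm]
  refine Finset.sum_congr rfl fun i _ => Finset.sum_congr rfl fun j _ =>
    Finset.sum_congr rfl fun k _ => ?_
  rw [hs k j]; ring

lemma schur_facts {p : ℕ} (pa : Fin p → Finset (Fin p)) (i : Fin p) (hi : i ∉ pa i)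
    (V : Matrix (Fin p) (Fin p) ℝ) (hV : V.PosDef) :
    (subGT pa V i).PosDef ∧ (subGE pa V i).PosDef ∧
    (subGE pa V i).det = (subGT pa V i).det *
      (V i i - (fun a : {j // j ∈ pa i} => V i a.1) ⬝ᵥ
        ((subGT pa V i)⁻¹ *ᵥ (fun a : {j // j ∈ pa i} => V i a.1))) := by
  have hT : Vᵀ = V := by
    have := hV.isHermitian; rwa [IsHermitian, conjTranspose_eq_transpose_of_trivial] at this
  have hs : ∀ a b, V a b = V b a := fun a b => congrFun (congrFun hT b) a
  have h1 : (subGT pa V i).PosDef :=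
    hV.submatrix (e := (Subtype.val : {j // j ∈ pa i} → Fin p)) Subtype.val_injective
  refine ⟨h1, ?_, ?_⟩
  · have he : Function.Injective (Sum.elim (fun _ => i) Subtype.val :
        Unit ⊕ {j // j ∈ pa i} → Fin p) := by
      rintro (x | x) (y | y) h
      · rfl
      · have h : i = y.1 := h
        have h5 := y.2
        rw [← h] at h5
        exact absurd h5 hi
      · have h : x.1 = i := h
        have h5 := x.2
        rw [h] at h5
        exact absurd h5 hi
      · exact congrArg _ (Subtype.val_injective h)
    convert hV.submatrix he using 1
    ext (x | x) (y | y) <;> rfl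
  · have : Invertible (subGT pa V i) :=
      Matrix.invertibleOfIsUnitDet _ (isUnit_iff_ne_zero.2 h1.det_pos.ne')
    rw [subGE, Matrix.det_fromBlocks₂₂, Matrix.det_unique (n := Unit), invOf_eq_nonsing_inv]
    congr 1
    simp only [Matrix.sub_apply, Matrix.of_apply, Matrix.mul_assoc]
    congr 1
    rw [Matrix.mul_apply]
    simp only [dotProduct, mulVec, Matrix.mul_apply, Matrix.of_apply]
    refine Finset.sum_congr rfl fun a _ => ?_
    congr 1
    refine Finset.sum_congr rfl fun b _ => ?_
    rw [hs]

lemma dagWishart_norm {p : ℕ} (pa : Fin p → Finset (Fin p))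
    (hpa : ∀ i : Fin p, ∀ j ∈ pa i, i < j)
    (V : Matrix (Fin p) (Fin p) ℝ) (hV : V.PosDef) (α : Fin p → ℝ)
    (hα : ∀ i : Fin p, 2 < α i - ((pa i).card : ℝ)) :
    ∫ l : ∀ i : Fin p, {j // j ∈ pa i} → ℝ, ∫ d : Fin p → ℝ,
      Real.exp (-(1 / 2) * Matrix.trace
        ((cholFactor pa l * (Matrix.diagonal d)⁻¹ * (cholFactor pa l).transpose) * V))
      * (∏ i : Fin p, (d i) ^ (-(α i) / 2))
      * (if ∀ i, 0 < d i then 1 else 0) = zDAG pa V α := by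
  have hi : ∀ i, i ∉ pa i := fun i h => lt_irrefl _ (hpa i i h)
  have hT : Vᵀ = V := by
    have := hV.isHermitian; rwa [IsHermitian, conjTranspose_eq_transpose_of_trivial] at this
  set F : ∀ i : Fin p, ({j // j ∈ pa i} → ℝ) → ℝ → ℝ := fun i l d =>
    (Set.Ioi (0:ℝ)).indicator (fun d => d ^ (-α i/2) *
       Real.exp (-(V i i + 2 * ((fun a : {j // j ∈ pa i} => V i a.1) ⬝ᵥ l)
        + l ⬝ᵥ (subGT pa V i *ᵥ l)) / (2 * d))) d with hF
  have key : ∀ (l : ∀ i : Fin p, {j // j ∈ pa i} → ℝ) (d : Fin p → ℝ),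
      Real.exp (-(1 / 2) * Matrix.trace
        ((cholFactor pa l * (Matrix.diagonal d)⁻¹ * (cholFactor pa l).transpose) * V))
      * (∏ i : Fin p, (d i) ^ (-(α i) / 2))
      * (if ∀ i, 0 < d i then 1 else 0) = ∏ i, F i (l i) (d i) := by
    intro l d
    by_cases hd : ∀ i, 0 < d i
    · have hinv : (Matrix.diagonal d)⁻¹ = Matrix.diagonal (fun i => (d i)⁻¹) := by
        apply Matrix.inv_eq_right_inv
        rw [Matrix.diagonal_mul_diagonal, ← Matrix.diagonal_one]
        congr 1
        funext i
        exact mul_inv_cancel₀ (hd i).ne'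
      rw [if_pos hd, mul_one, hinv, trace_quad _ _ _ hT]
      simp_rw [fun i => col_quad pa i (hi i) l V hT]
      rw [Finset.mul_sum, Real.exp_sum, ← Finset.prod_mul_distrib]
      refine Finset.prod_congr rfl fun i _ => ?_
      simp only [hF]
      rw [Set.indicator_of_mem (show d i ∈ Set.Ioi 0 from hd i), mul_comm]
      congr 2
      have := (hd i).ne'
      field_simp
    · rw [if_neg hd, mul_zero]
      push Not at hd
      obtain ⟨i, hdi⟩ := hd
      symm
      apply Finset.prod_eq_zero (Finset.mem_univ i)
      simp only [hF]
      rw [Set.indicator_of_notMem]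
      simpa using hdi
  simp_rw [key]
  have h2 : ∀ l : ∀ i : Fin p, {j // j ∈ pa i} → ℝ,
      ∫ d : Fin p → ℝ, ∏ i, F i (l i) (d i) = ∏ i, ∫ x : ℝ, F i (l i) x := fun l =>
    integral_fintype_prod_volume_eq_prod (fun i x => F i (l i) x)
  simp_rw [h2]
  rw [integral_fintype_prod_volume_eq_prod (fun i (y : {j // j ∈ pa i} → ℝ) => ∫ x : ℝ, F i y x)]
  unfold zDAG
  refine Finset.prod_congr rfl fun i _ => ?_
  obtain ⟨hGT, hGE, hdet⟩ := schur_facts pa i (hi i) V hV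
  have hs : 0 < V i i - (fun a : {j // j ∈ pa i} => V i a.1) ⬝ᵥ
        ((subGT pa V i)⁻¹ *ᵥ (fun a : {j // j ∈ pa i} => V i a.1)) := by
    have := hGE.det_pos
    rw [hdet] at this
    exact (mul_pos_iff_of_pos_left hGT.det_pos).1 this
  have hcard : Fintype.card {j // j ∈ pa i} = (pa i).card := Fintype.card_coe _
  have := vertex_int (subGT pa V i) hGT (fun a : {j // j ∈ pa i} => V i a.1) (V i i) (α i) hs
    (by rw [hcard]; exact hα i)
  simp only [hF]
  rw [this, hcard, hdet, Real.mul_rpow hGT.det_pos.le hs.le, Real.rpow_neg hs.le,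
    show α i / 2 - ((pa i).card : ℝ) / 2 - 3 / 2
      = (α i / 2 - ((pa i).card : ℝ) / 2 - 1) + (-(1:ℝ)/2) by ring,
    Real.rpow_add hGT.det_pos]
  have h3 := Real.rpow_pos_of_pos hGT.det_pos (α i / 2 - ((pa i).card : ℝ) / 2 - 1)
  have h4 := Real.rpow_pos_of_pos hs (α i / 2 - ((pa i).card : ℝ) / 2 - 1)
  generalize (subGT pa V i).det ^ (α i / 2 - ((pa i).card : ℝ) / 2 - 1) = P at h3 ⊢
  generalize (V i i - (fun a : {j // j ∈ pa i} => V i a.1) ⬝ᵥ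
        ((subGT pa V i)⁻¹ *ᵥ (fun a : {j // j ∈ pa i} => V i a.1)))
          ^ (α i / 2 - ((pa i).card : ℝ) / 2 - 1) = Q at h4 ⊢
  field_simp

lemma det_chol {p : ℕ} (pa : Fin p → Finset (Fin p))
    (hpa : ∀ i : Fin p, ∀ j ∈ pa i, i < j) (l : ∀ i : Fin p, {j // j ∈ pa i} → ℝ) :
    (cholFactor pa l).det = 1 := by
  rw [Matrix.det_of_isLowerTriangular]
  · simp [cholFactor]
  · intro i j hij
    have hij : i < j := hij
    unfold cholFactor
    rw [if_neg hij.ne, dif_neg]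
    intro h
    exact absurd (hpa j i h) (not_lt.2 hij.le)

lemma trace_gram {n p : ℕ} (X : Matrix (Fin n) (Fin p) ℝ) (Ω : Matrix (Fin p) (Fin p) ℝ) :
    Matrix.trace (Ω * (Xᵀ * X)) = ∑ k, X k ⬝ᵥ (Ω *ᵥ X k) := by
  rw [← Matrix.mul_assoc, Matrix.trace_mul_comm, ← Matrix.mul_assoc, Matrix.trace]
  refine Finset.sum_congr rfl fun k _ => ?_
  rw [dotProduct_mulVec]
  rfl

lemma dag_marginal {n p : ℕ} (X : Matrix (Fin n) (Fin p) ℝ)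
    (U : Matrix (Fin p) (Fin p) ℝ) (hU : U.PosDef) (pa : Fin p → Finset (Fin p))
    (hpa : ∀ i : Fin p, ∀ j ∈ pa i, i < j) (α : Fin p → ℝ)
    (hα : ∀ i : Fin p, 2 < α i - ((pa i).card : ℝ)) :
    (∫ l : ∀ i : Fin p, {j // j ∈ pa i} → ℝ, ∫ d : Fin p → ℝ,
                dagWishartDensity pa U α d l
                  * ∏ k : Fin n,
                      gaussDensity
                        (cholFactor pa l * (Matrix.diagonal d)⁻¹
                          * (cholFactor pa l).transpose) (X k))
    = ((2 * π) ^ (-(p : ℝ) / 2)) ^ n *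
      (zDAG pa (U + X.transpose * X) (fun i => (n : ℝ) + α i) / zDAG pa U α) := by
  have hV : (U + Xᵀ * X).PosDef := by
    refine hU.add_posSemidef ?_
    have := Matrix.posSemidef_conjTranspose_mul_self X
    rwa [conjTranspose_eq_transpose_of_trivial] at this
  rw [← dagWishart_norm pa hpa (U + Xᵀ * X) hV (fun i => (n : ℝ) + α i)
    (fun i => by have := hα i; have : (0:ℝ) ≤ n := Nat.cast_nonneg n; linarith),
    div_eq_inv_mul (b := zDAG pa U α), ← mul_assoc, ← integral_const_mul]
  congr 1
  funext l
  rw [← integral_const_mul]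
  congr 1
  funext d
  unfold dagWishartDensity
  by_cases hd : ∀ i, 0 < d i
  · simp only [if_pos hd, mul_one]
    have hdet : (cholFactor pa l * (Matrix.diagonal d)⁻¹ * (cholFactor pa l).transpose).det
        = ∏ i, (d i)⁻¹ := by
      rw [det_mul, det_mul, det_transpose, det_chol pa hpa, det_nonsing_inv, det_diagonal]
      simp
    unfold gaussDensity
    rw [Finset.prod_mul_distrib, Finset.prod_const, Finset.card_univ, Fintype.card_fin, hdet,
      ← Real.exp_sum, ← Finset.mul_sum, ← trace_gram, mul_add, Matrix.trace_add, mul_add,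
      Real.exp_add, mul_pow]
    have : ∏ i, d i ^ (-((n:ℝ) + α i) / 2)
        = ((∏ i, (d i)⁻¹) ^ ((1:ℝ)/2)) ^ n * ∏ i, d i ^ (-α i / 2) := by
      rw [← Real.finsetProd_rpow _ _ (fun i _ => (inv_pos.2 (hd i)).le), ← Finset.prod_pow,
        ← Finset.prod_mul_distrib]
      refine Finset.prod_congr rfl fun i _ => ?_
      rw [Real.inv_rpow (hd i).le, ← Real.rpow_neg (hd i).le, ← Real.rpow_natCast,
        ← Real.rpow_mul (hd i).le, ← Real.rpow_add (hd i)]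
      congr 1
      ring
    rw [this]
    ring
  · simp only [if_neg hd]; simp

lemma beta_marginal {n p : ℕ} (X : Matrix (Fin n) (Fin p) ℝ) (Y : Fin n → ℝ)
    (σ τ : ℝ) (hσ : 0 < σ) (hτ : 0 < τ) (γ : Fin p → Bool) :
    (∫ β : {i // γ i = true} → ℝ,
                ((2 * π * σ ^ 2) ^ (-(n : ℝ) / 2)
                    * Real.exp (-((Y - designSub X γ *ᵥ β) ⬝ᵥ (Y - designSub X γ *ᵥ β))
                        / (2 * σ ^ 2)))
                  * ((2 * π * τ ^ 2 * σ ^ 2) ^ (-((Finset.univ.filter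
                        (fun i => γ i = true)).card : ℝ) / 2)
                    * Real.exp (-(β ⬝ᵥ β) / (2 * τ ^ 2 * σ ^ 2))))
    = (2 * π * σ ^ 2) ^ (-(n : ℝ) / 2) *
       (Matrix.det ((τ ^ 2) • ((designSub X γ).transpose * designSub X γ) + 1)
                  ^ (-(1 : ℝ) / 2)
              * Real.exp (-(Y ⬝ᵥ
                  ((1 + (τ ^ 2) • (designSub X γ * (designSub X γ).transpose))⁻¹ *ᵥ Y))
                  / (2 * σ ^ 2))) := by
  rw [← Fintype.card_subtype (fun i => γ i = true)]
  generalize designSub X γ = Z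
  set k : ℝ := (Fintype.card {i // γ i = true} : ℝ) with hk
  have hZ : (Zᵀ * Z).PosSemidef := by
    have := Matrix.posSemidef_conjTranspose_mul_self Z
    rwa [conjTranspose_eq_transpose_of_trivial] at this
  have hB : ((τ ^ 2) • (Zᵀ * Z) + 1).PosDef :=
    Matrix.PosDef.posSemidef_add (hZ.smul (by positivity)) Matrix.PosDef.one
  set B := (τ ^ 2) • (Zᵀ * Z) + 1 with hBdef
  set A := (τ ^ 2)⁻¹ • B with hAdef
  have hA : A.PosDef := hB.smul (by positivity)
  have hAe : A = Zᵀ * Z + (τ ^ 2)⁻¹ • 1 := by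
    rw [hAdef, hBdef, smul_add, smul_smul, inv_mul_cancel₀ (by positivity), one_smul]
  have hBu : IsUnit B.det := isUnit_iff_ne_zero.2 hB.det_pos.ne'
  have hAu : IsUnit A.det := isUnit_iff_ne_zero.2 hA.det_pos.ne'
  have hwood : (1 + (τ ^ 2) • (Z * Zᵀ))⁻¹ = 1 - Z * A⁻¹ * Zᵀ := by
    apply Matrix.inv_eq_right_inv
    have h1 : (1 + (τ ^ 2) • (Z * Zᵀ)) * Z = (τ ^ 2) • (Z * A) := by
      rw [hAdef, Matrix.mul_smul, smul_smul, mul_inv_cancel₀ (by positivity), one_smul, hBdef,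
        Matrix.add_mul, Matrix.mul_add, Matrix.mul_smul, Matrix.smul_mul, Matrix.mul_one,
        Matrix.one_mul, Matrix.mul_assoc, add_comm]
    rw [Matrix.mul_sub, Matrix.mul_one, ← Matrix.mul_assoc, ← Matrix.mul_assoc, h1,
      Matrix.smul_mul, Matrix.mul_assoc Z, mul_nonsing_inv _ hAu, Matrix.mul_one,
      Matrix.smul_mul]
    simp
  have hS : Y ⬝ᵥ Y - (-(Zᵀ *ᵥ Y)) ⬝ᵥ (A⁻¹ *ᵥ (-(Zᵀ *ᵥ Y)))
      = Y ⬝ᵥ ((1 + (τ ^ 2) • (Z * Zᵀ))⁻¹ *ᵥ Y) := by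
    rw [hwood, sub_mulVec, one_mulVec, dotProduct_sub, mulVec_neg, neg_dotProduct_neg,
      ← mulVec_mulVec, ← mulVec_mulVec, dotProduct_mulVec Y Z, ← mulVec_transpose]
  have e : ∀ β : {i // γ i = true} → ℝ,
      ((2 * π * σ ^ 2) ^ (-(n : ℝ) / 2)
          * Real.exp (-((Y - Z *ᵥ β) ⬝ᵥ (Y - Z *ᵥ β)) / (2 * σ ^ 2)))
        * ((2 * π * τ ^ 2 * σ ^ 2) ^ (-k / 2)
          * Real.exp (-(β ⬝ᵥ β) / (2 * τ ^ 2 * σ ^ 2)))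
      = ((2 * π * σ ^ 2) ^ (-(n : ℝ) / 2) * (2 * π * τ ^ 2 * σ ^ 2) ^ (-k / 2)) *
        Real.exp (-(Y ⬝ᵥ Y + 2 * ((-(Zᵀ *ᵥ Y)) ⬝ᵥ β) + β ⬝ᵥ (A *ᵥ β)) / (2 * σ ^ 2)) := by
    intro β
    have hq : -(Y ⬝ᵥ Y + 2 * ((-(Zᵀ *ᵥ Y)) ⬝ᵥ β) + β ⬝ᵥ (A *ᵥ β)) / (2 * σ ^ 2)
        = -((Y - Z *ᵥ β) ⬝ᵥ (Y - Z *ᵥ β)) / (2 * σ ^ 2)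
          + -(β ⬝ᵥ β) / (2 * τ ^ 2 * σ ^ 2) := by
      have h1 : (Zᵀ *ᵥ Y) ⬝ᵥ β = Y ⬝ᵥ (Z *ᵥ β) := by
        rw [dotProduct_mulVec, mulVec_transpose]
      have h2 : β ⬝ᵥ (A *ᵥ β) = (Z *ᵥ β) ⬝ᵥ (Z *ᵥ β) + (τ ^ 2)⁻¹ * (β ⬝ᵥ β) := by
        rw [hAe, add_mulVec, dotProduct_add, smul_mulVec, one_mulVec, dotProduct_smul,
          smul_eq_mul, ← mulVec_mulVec, dotProduct_mulVec β, vecMul_transpose]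
      rw [neg_dotProduct, h1, h2, sub_dotProduct, dotProduct_sub, dotProduct_sub,
        dotProduct_comm (Z *ᵥ β) Y]
      field_simp
      ring
    rw [hq, Real.exp_add]
    ring
  simp_rw [e]
  rw [integral_const_mul, (gauss_shift A hA _ _ (σ ^ 2) (by positivity)).2, hS, ← hk, hAdef,
    det_smul, Real.mul_rpow (by positivity) hB.det_pos.le, ← Real.rpow_natCast (τ ^ 2)⁻¹,
    ← Real.rpow_mul (x := (τ ^ 2)⁻¹) (by positivity), ← hk, Real.inv_rpow (by positivity),
    ← Real.rpow_neg (by positivity), show -(k * (-1/2)) = k/2 by ring,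
    show 2 * π * τ ^ 2 * σ ^ 2 = (2 * π) * (σ ^ 2) * (τ ^ 2) by ring,
    Real.mul_rpow (x := (2 * π) * (σ ^ 2)) (by positivity) (by positivity),
    Real.mul_rpow (x := (2 * π)) (y := σ ^ 2) (z := -k/2) (by positivity) (by positivity),
    show -k/2 = -(k/2) by ring, Real.rpow_neg (by positivity), Real.rpow_neg (by positivity),
    Real.rpow_neg (by positivity)]
  have := Real.rpow_pos_of_pos (show 0 < 2 * π by positivity) (k/2)
  have := Real.rpow_pos_of_pos (show 0 < σ ^ 2 by positivity) (k/2)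
  have := Real.rpow_pos_of_pos (show 0 < τ ^ 2 by positivity) (k/2)
  field_simp

/-- Lemma 1 (marginal joint posterior): under the hierarchical model
`Y | X_γ, β_γ ~ N_n(X_γ β_γ, σ² Iₙ)`, `Xᵢ | (L,D) ~ N_p(0, (L D⁻¹ Lᵀ)⁻¹)`,
`(L,D) | 𝒟 ~` DAG-Wishart `π^{Θ_𝒟}_{U,α}`, `β_γ | γ ~ N(0, τ²σ² I)`, with Erdos–Renyi prior
on the DAG `𝒟` and MRF prior `π(γ|𝒟)`, the marginal joint posterior of `(γ, 𝒟)` (obtained by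
integrating out `β_γ` and `(L,D)`) satisfies
`π(γ, 𝒟 | Y, X) ∝ π(γ|𝒟) π(𝒟) · [z_𝒟(U+XᵀX, n+α)/z_𝒟(U, α)] ·
det(τ² X_γᵀ X_γ + I)^{−1/2} exp{−(1/2σ²) Yᵀ(Iₙ + τ² X_γ X_γᵀ)⁻¹ Y}`,
where the proportionality constant depends only on the data `(Y, X)`. -/
theorem joint_posterior_form {n p : ℕ} (hn : 0 < n)
    (X : Matrix (Fin n) (Fin p) ℝ) (Y : Fin n → ℝ)
    (σ τ a b q : ℝ) (hσ : 0 < σ) (hτ : 0 < τ) (ha : 0 < a) (hb : 0 ≤ b)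
    (hq : 0 < q) (hq1 : q < 1) (R : ℕ) (hR : 0 < R)
    (U : Matrix (Fin p) (Fin p) ℝ) (hU : U.PosDef)
    (α : (Fin p → Finset (Fin p)) → Fin p → ℝ)
    (hα : ∀ pa, ∀ i : Fin p, 2 < α pa i - ((pa i).card : ℝ)) :
    ∃ c : ℝ, 0 < c ∧
      ∀ (γ : Fin p → Bool) (pa : Fin p → Finset (Fin p)),
        (∀ i : Fin p, ∀ j ∈ pa i, i < j) →
        mrfPrior a b R pa γ * dagPrior q R pa
            * (∫ l : ∀ i : Fin p, {j // j ∈ pa i} → ℝ, ∫ d : Fin p → ℝ,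
                dagWishartDensity pa U (α pa) d l
                  * ∏ k : Fin n,
                      gaussDensity
                        (cholFactor pa l * (Matrix.diagonal d)⁻¹
                          * (cholFactor pa l).transpose) (X k))
            * (∫ β : {i // γ i = true} → ℝ,
                ((2 * π * σ ^ 2) ^ (-(n : ℝ) / 2)
                    * Real.exp (-((Y - designSub X γ *ᵥ β) ⬝ᵥ (Y - designSub X γ *ᵥ β))
                        / (2 * σ ^ 2)))
                  * ((2 * π * τ ^ 2 * σ ^ 2) ^ (-((Finset.univ.filter
                        (fun i => γ i = true)).card : ℝ) / 2)
                    * Real.exp (-(β ⬝ᵥ β) / (2 * τ ^ 2 * σ ^ 2))))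
          = c * (mrfPrior a b R pa γ * dagPrior q R pa
              * (zDAG pa (U + X.transpose * X) (fun i => (n : ℝ) + α pa i)
                  / zDAG pa U (α pa))
              * Matrix.det ((τ ^ 2) • ((designSub X γ).transpose * designSub X γ) + 1)
                  ^ (-(1 : ℝ) / 2)
              * Real.exp (-(Y ⬝ᵥ
                  ((1 + (τ ^ 2) • (designSub X γ * (designSub X γ).transpose))⁻¹ *ᵥ Y))
                  / (2 * σ ^ 2))) := by
  refine ⟨((2 * π) ^ (-(p : ℝ) / 2)) ^ n * (2 * π * σ ^ 2) ^ (-(n : ℝ) / 2), by positivity, ?_⟩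
  intro γ pa hpa
  rw [dag_marginal X U hU pa hpa (α pa) (hα pa), beta_marginal X Y σ τ hσ hτ γ]
  ring

end
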